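/- arXiv:1912.11596 — 3 statements merged into one kernel-verified Lean document; each statement's English description precedes it below -/
import Mathlib

section
/- Let Z be a semi-negative continuous linear operator on V with ‖Z‖ ≤ λ for some λ ≥ 0, and let R(Z) = Σ_{k=0}^s α_k Z^k with α_0 = 1. Set B := Σ_{k=1}^s |α_k| λ^{k−1}. Then for every integer l ≥ 0, every ε > 0, and every v ∈ V, | [Zˡ R(Z)v]² − [Zˡ v]² | ≤ ε [Zˡ v]² + 2λ(1 + 1/ε) B² ‖Z^{l+1} v‖². -/
open RealInnerProductSpace

/-- The semi-inner-product `[v, w] := −⟨Zv, w⟩ − ⟨v, Zw⟩` associated with `Z`. -/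
noncomputable def semiIP {V : Type*} [NormedAddCommGroup V] [InnerProductSpace ℝ V]
    (Z : V →L[ℝ] V) (v w : V) : ℝ :=
  -⟪Z v, w⟫ - ⟪v, Z w⟫

/-- The quadratic form of `semiIP` is nonnegative for a semi-negative operator. -/
theorem semiIP_self_nonneg {V : Type*} [NormedAddCommGroup V] [InnerProductSpace ℝ V]
    {Z : V →L[ℝ] V} (hZ : ∀ v : V, ⟪Z v, v⟫ ≤ 0) (v : V) : 0 ≤ semiIP Z v v := by
  have h := hZ v
  have h' := real_inner_comm v (Z v)
  unfold semiIP
  linarith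

theorem semiIP_self_le {V : Type*} [NormedAddCommGroup V] [InnerProductSpace ℝ V]
    (Z : V →L[ℝ] V) (v : V) : semiIP Z v v ≤ 2 * ‖Z‖ * ‖v‖ ^ 2 := by
  have h := neg_le_of_abs_le (abs_real_inner_le_norm (Z v) v)
  have h' := real_inner_comm v (Z v)
  have hn := mul_le_mul_of_nonneg_right (Z.le_opNorm v) (norm_nonneg v)
  unfold semiIP
  linarith

theorem semiIP_smul_add_self {V : Type*} [NormedAddCommGroup V] [InnerProductSpace ℝ V]
    (Z : V →L[ℝ] V) (c : ℝ) (u w : V) :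
    semiIP Z (c • u + w) (c • u + w)
      = c ^ 2 * semiIP Z u u + 2 * c * semiIP Z u w + semiIP Z w w := by
  simp only [semiIP, map_add, map_smul, inner_add_left, inner_add_right, real_inner_smul_left,
    real_inner_smul_right, real_inner_comm (Z w) u, real_inner_comm (Z u) w,
    real_inner_comm (Z u) u, real_inner_comm (Z w) w]
  ring

/-- Perturbing `u` by `w` changes its squared seminorm by a controlled amount
(Young's inequality). -/
theorem abs_semiIP_add_self_sub_le {V : Type*} [NormedAddCommGroup V] [InnerProductSpace ℝ V]
    {Z : V →L[ℝ] V} (hZ : ∀ v : V, ⟪Z v, v⟫ ≤ 0) {ε : ℝ} (hε : 0 < ε) (u w : V) :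
    |semiIP Z (u + w) (u + w) - semiIP Z u u|
      ≤ ε * semiIP Z u u + (1 + 1 / ε) * semiIP Z w w := by
  have hw := semiIP_self_nonneg hZ w
  have hp := semiIP_self_nonneg hZ (ε • u + w)
  have hm := semiIP_self_nonneg hZ ((-ε) • u + w)
  have h1 := semiIP_smul_add_self Z 1 u w
  rw [semiIP_smul_add_self] at hp hm
  rw [one_smul] at h1
  have hi : ε * (1 / ε) = 1 := by field_simp
  have hi0 : 0 ≤ 1 / ε := by positivity
  have hp' := mul_nonneg hi0 hp
  have hm' := mul_nonneg hi0 hm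
  have ep : 1 / ε * (ε ^ 2 * semiIP Z u u + 2 * ε * semiIP Z u w + semiIP Z w w)
      = ε * semiIP Z u u + 2 * semiIP Z u w + 1 / ε * semiIP Z w w := by
    field_simp
  have em : 1 / ε * ((-ε) ^ 2 * semiIP Z u u + 2 * (-ε) * semiIP Z u w + semiIP Z w w)
      = ε * semiIP Z u u - 2 * semiIP Z u w + 1 / ε * semiIP Z w w := by
    field_simp
    ring
  rw [ep] at hp'
  rw [em] at hm'
  rw [h1, abs_le]
  constructor <;> linarith

theorem norm_sum_smul_pow_le {V : Type*} [NormedAddCommGroup V] [NormedSpace ℝ V]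
    (Z : V →L[ℝ] V) {lam : ℝ} (hZle : ‖Z‖ ≤ lam) (s : ℕ) (a : ℕ → ℝ) (x : V) :
    ‖(∑ k ∈ Finset.range s, a k • Z ^ k) x‖
      ≤ (∑ k ∈ Finset.range s, |a k| * lam ^ k) * ‖x‖ := by
  have hpow : ∀ k : ℕ, ‖(Z ^ k) x‖ ≤ lam ^ k * ‖x‖ := by
    intro k
    induction k with
    | zero => simp
    | succ k ih =>
      rw [pow_succ', mul_apply_eq_comp, pow_succ', mul_assoc]
      exact Z.le_of_opNorm_le_of_le hZle ih
  rw [sum_apply, Finset.sum_mul]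
  refine norm_sum_le_of_le _ fun k _ => ?_
  rw [smul_apply, norm_smul, Real.norm_eq_abs, mul_assoc]
  exact mul_le_mul_of_nonneg_left (hpow k) (abs_nonneg _)

/-- For a semi-negative operator `Z` with `‖Z‖ ≤ λ` and the RK operator
`R(Z) = Σ_{k=0}^s α_k Z^k` with `α_0 = 1`, setting `B := Σ_{k=1}^s |α_k| λ^(k−1)`, we have
`| [Zˡ R(Z)v]² − [Zˡ v]² | ≤ ε [Zˡ v]² + 2λ(1 + 1/ε) B² ‖Z^(l+1) v‖²` for every `ε > 0`. -/
theorem semiSq_pow_RK_sub_le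
    {V : Type*} [NormedAddCommGroup V] [InnerProductSpace ℝ V] [CompleteSpace V]
    (Z : V →L[ℝ] V) (hZ : ∀ v : V, ⟪Z v, v⟫ ≤ 0)
    (lam : ℝ) (hlam : 0 ≤ lam) (hZle : ‖Z‖ ≤ lam)
    (s : ℕ) (α : ℕ → ℝ) (hα0 : α 0 = 1)
    (B : ℝ) (hB : B = ∑ k ∈ Finset.Icc 1 s, |α k| * lam ^ (k - 1))
    (l : ℕ) (ε : ℝ) (hε : 0 < ε) (v : V) :
    |semiIP Z ((Z ^ l) ((∑ k ∈ Finset.range (s + 1), α k • Z ^ k) v))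
        ((Z ^ l) ((∑ k ∈ Finset.range (s + 1), α k • Z ^ k) v))
      - semiIP Z ((Z ^ l) v) ((Z ^ l) v)|
      ≤ ε * semiIP Z ((Z ^ l) v) ((Z ^ l) v)
        + 2 * lam * (1 + 1 / ε) * B ^ 2 * ‖(Z ^ (l + 1)) v‖ ^ 2 := by
  have hB' : B = ∑ k ∈ Finset.range s, |α (k + 1)| * lam ^ k := by
    have h := Finset.sum_Ico_add' (fun k => |α k| * lam ^ (k - 1)) 0 s 1
    simp only [Nat.add_sub_cancel, zero_add] at h
    rw [hB, Finset.range_eq_Ico, h]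
    refine Finset.sum_congr ?_ fun _ _ => rfl
    ext k
    simp only [Finset.mem_Icc, Finset.mem_Ico]
    omega
  set P : V →L[ℝ] V := ∑ k ∈ Finset.range s, α (k + 1) • Z ^ k with hP
  have hR : Z ^ l * (∑ k ∈ Finset.range (s + 1), α k • Z ^ k) = Z ^ l + P * Z ^ (l + 1) := by
    rw [Finset.sum_range_succ', hα0, hP, Finset.sum_mul, mul_add, Finset.mul_sum, add_comm]
    congr 1
    · simp
    · refine Finset.sum_congr rfl fun k _ => ?_
      rw [mul_smul_comm, smul_mul_assoc, ← pow_add, ← pow_add]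
      congr 2
      omega
  have hRv := congrArg (fun T : V →L[ℝ] V => T v) hR
  simp only [mul_apply_eq_comp, add_apply] at hRv
  rw [hRv]
  set x := (Z ^ (l + 1)) v
  have hPx : ‖P x‖ ≤ B * ‖x‖ := by
    rw [hB']
    exact norm_sum_smul_pow_le Z hZle s (fun k => α (k + 1)) x
  have hw : semiIP Z (P x) (P x) ≤ 2 * lam * (B * ‖x‖) ^ 2 :=
    (semiIP_self_le Z (P x)).trans (by gcongr)
  calc _ ≤ ε * semiIP Z ((Z ^ l) v) ((Z ^ l) v) + (1 + 1 / ε) * semiIP Z (P x) (P x) :=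
        abs_semiIP_add_self_sub_le hZ hε _ _
    _ ≤ ε * semiIP Z ((Z ^ l) v) ((Z ^ l) v) + (1 + 1 / ε) * (2 * lam * (B * ‖x‖) ^ 2) := by
        gcongr
    _ = _ := by ring
end

section
/- Let Z be a semi-negative continuous linear operator on V, let k ≥ 1 be an integer and μ, ν ∈ ℝ. For any w ∈ V set u_F := w + μ (Z†)^{k−1} Z^k w + ν (Z†)^k Z^k w. Then the exact energy identity holds: ‖u_F‖² = ‖w‖² − μ [Z^{k−1} w]² + 2ν ‖Z^k w‖² + ‖(μ·I + ν Z†)((Z†)^{k−1} Z^k w)‖². -/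
open RealInnerProductSpace

theorem real_inner_adjoint_pow_right {V : Type*} [NormedAddCommGroup V] [InnerProductSpace ℝ V]
    [CompleteSpace V] (Z : V →L[ℝ] V) (n : ℕ) (x y : V) :
    ⟪x, (ContinuousLinearMap.adjoint Z ^ n) y⟫ = ⟪(Z ^ n) x, y⟫ := by
  rw [← ContinuousLinearMap.star_eq_adjoint, ← star_pow,
    ContinuousLinearMap.star_eq_adjoint, ContinuousLinearMap.adjoint_inner_right]

/-- exact energy identity for the filtering step
`u_F := w + μ (Z†)^(k−1) Z^k w + ν (Z†)^k Z^k w`: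
`‖u_F‖² = ‖w‖² − μ [Z^(k−1) w]² + 2ν ‖Z^k w‖² + ‖(μ I + ν Z†)((Z†)^(k−1) Z^k w)‖²`. -/
theorem filter_energy_identity
    {V : Type*} [NormedAddCommGroup V] [InnerProductSpace ℝ V] [CompleteSpace V]
    (Z : V →L[ℝ] V) (hZ : ∀ v : V, ⟪Z v, v⟫ ≤ 0)
    (k : ℕ) (hk : 1 ≤ k) (μ ν : ℝ) (w : V) :
    ‖w + μ • ((ContinuousLinearMap.adjoint Z ^ (k - 1)) ((Z ^ k) w))
        + ν • ((ContinuousLinearMap.adjoint Z ^ k) ((Z ^ k) w))‖ ^ 2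
      = ‖w‖ ^ 2 - μ * semiIP Z ((Z ^ (k - 1)) w) ((Z ^ (k - 1)) w)
        + 2 * ν * ‖(Z ^ k) w‖ ^ 2
        + ‖(μ • (1 : V →L[ℝ] V) + ν • ContinuousLinearMap.adjoint Z)
            ((ContinuousLinearMap.adjoint Z ^ (k - 1)) ((Z ^ k) w))‖ ^ 2 := by
  obtain ⟨n, rfl⟩ := Nat.exists_eq_add_of_le' hk
  have hdiss : semiIP Z ((Z ^ n) w) ((Z ^ n) w) = -2 * ⟪(Z ^ n) w, (Z ^ (n + 1)) w⟫ := by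
    rw [semiIP, real_inner_comm, pow_succ', mul_apply_eq_comp]
    ring
  have happly : (μ • (1 : V →L[ℝ] V) + ν • ContinuousLinearMap.adjoint Z)
      ((ContinuousLinearMap.adjoint Z ^ n) ((Z ^ (n + 1)) w)) =
      μ • (ContinuousLinearMap.adjoint Z ^ n) ((Z ^ (n + 1)) w)
        + ν • (ContinuousLinearMap.adjoint Z ^ (n + 1)) ((Z ^ (n + 1)) w) := by
    simp [pow_succ' (ContinuousLinearMap.adjoint Z)]
  rw [Nat.add_sub_cancel, happly, add_assoc, norm_add_sq_real, inner_add_right,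
    real_inner_smul_right, real_inner_smul_right, real_inner_adjoint_pow_right,
    real_inner_adjoint_pow_right, real_inner_self_eq_norm_sq, hdiss]
  ring
end

section
/- Let Z be a semi-negative continuous linear operator on V, let k ≥ 1 be an integer and μ, ν ∈ ℝ, and define the modified operator Z̃ := Z + μ (Z†)^{k−1} Z^k + ν (Z†)^k Z^k. Then for every v ∈ V one has ⟨Z̃v, v⟩ = ⟨Zv, v⟩ − (μ/2) [Z^{k−1} v]² + ν ‖Z^k v‖². In particular, if μ ≥ 0 and ν ≤ 0 then Z̃ is also semi-negative: ⟨Z̃v, v⟩ ≤ 0 for all v ∈ V. -/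
open RealInnerProductSpace

theorem inner_adjoint_pow_left {V : Type*} [NormedAddCommGroup V] [InnerProductSpace ℝ V]
    [CompleteSpace V] (Z : V →L[ℝ] V) (n : ℕ) (v w : V) :
    ⟪(ContinuousLinearMap.adjoint Z ^ n) v, w⟫ = ⟪v, (Z ^ n) w⟫ := by
  rw [← ContinuousLinearMap.star_eq_adjoint, ← star_pow, ContinuousLinearMap.star_eq_adjoint,
    ContinuousLinearMap.adjoint_inner_left]

/-- For the modified operator
`Z̃ := Z + μ (Z†)^(k−1) Z^k + ν (Z†)^k Z^k` we have
`⟨Z̃v, v⟩ = ⟨Zv, v⟩ − (μ/2)[Z^(k−1)v]² + ν‖Z^k v‖²` for every `v`, and in particular if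
`μ ≥ 0` and `ν ≤ 0` then `Z̃` is semi-negative. -/
theorem modified_operator_inner_eq
    {V : Type*} [NormedAddCommGroup V] [InnerProductSpace ℝ V] [CompleteSpace V]
    (Z : V →L[ℝ] V) (hZ : ∀ v : V, ⟪Z v, v⟫ ≤ 0)
    (k : ℕ) (hk : 1 ≤ k) (μ ν : ℝ)
    (Zt : V →L[ℝ] V)
    (hZt : Zt = Z + μ • (ContinuousLinearMap.adjoint Z ^ (k - 1) * Z ^ k)
        + ν • (ContinuousLinearMap.adjoint Z ^ k * Z ^ k)) :
    (∀ v : V, ⟪Zt v, v⟫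
        = ⟪Z v, v⟫ - (μ / 2) * semiIP Z ((Z ^ (k - 1)) v) ((Z ^ (k - 1)) v)
          + ν * ‖(Z ^ k) v‖ ^ 2)
      ∧ (0 ≤ μ → ν ≤ 0 → ∀ v : V, ⟪Zt v, v⟫ ≤ 0) := by
  have key : ∀ v : V, ⟪Zt v, v⟫
      = ⟪Z v, v⟫ - (μ / 2) * semiIP Z ((Z ^ (k - 1)) v) ((Z ^ (k - 1)) v)
        + ν * ‖(Z ^ k) v‖ ^ 2 := by
    intro v
    have hpow : (Z ^ k) v = Z ((Z ^ (k - 1)) v) := by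
      rw [← mul_pow_sub_one (Nat.one_le_iff_ne_zero.mp hk) Z, mul_apply_eq_comp]
    rw [hZt]
    simp only [add_apply, smul_apply, mul_apply_eq_comp,
      inner_add_left, real_inner_smul_left, inner_adjoint_pow_left, real_inner_self_eq_norm_sq]
    rw [hpow, semiIP, real_inner_comm (Z ((Z ^ (k - 1)) v))]
    ring
  refine ⟨key, fun hμ hν v => ?_⟩
  rw [key v]
  have hsemi := mul_nonneg (div_nonneg hμ zero_le_two) (semiIP_self_nonneg hZ ((Z ^ (k - 1)) v))
  have hnorm := mul_nonpos_of_nonpos_of_nonneg hν (sq_nonneg ‖(Z ^ k) v‖)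
  linarith [hZ v]
end
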